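/- (Proposition 1: two driver populations sharing one error signal, with two controllers.) Let d₁, d₂, d₃, d₄ be natural numbers with d = d₁ + d₂ + d₃ + d₄, and let 𝒜 be a d×d real matrix that is block lower triangular with respect to this decomposition, with diagonal blocks Â¹ = diag(A_1¹, …, A_{N₁}¹), Â² = diag(A_1², …, A_{N₂}²), A_c¹ and A_c², where every matrix A_i¹, A_i², A_c¹, A_c² is Schur. Let β₁, …, β_L ∈ ℝ^d and define W_ℓ(ξ) = 𝒜ξ + β_ℓ. Let p₁, …, p_L : ℝ^d → [0,1] be Dini continuous probability functions with Σ_ℓ p_ℓ(x) = 1 and p_ℓ(x) ≥ δ for some δ > 0 and all x. Then the Markov kernel κ(x) = Σ_ℓ p_ℓ(x)·δ_{W_ℓ(x)} admits a unique invariant Borel probability measure, and this measure is attractive. -/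

import Mathlib

open MeasureTheory Filter Topology

noncomputable section

/-- A real square matrix is Schur if every complex eigenvalue has modulus `< 1`. -/
def IsSchur {ι : Type*} [Fintype ι] [DecidableEq ι] (A : Matrix ι ι ℝ) : Prop :=
  ∀ z ∈ spectrum ℂ (A.map (fun x : ℝ => (x : ℂ))), ‖z‖ < 1

/-- `p` is Dini continuous: `|p x - p y| ≤ φ (dist x y)` for a nondecreasing modulus `φ` with
`φ 0 = 0` and `∫₀¹ φ t / t dt < ∞`. -/
def DiniContinuous {X : Type*} [PseudoMetricSpace X] (p : X → ℝ) : Prop :=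
  ∃ φ : ℝ → ℝ, MonotoneOn φ (Set.Ici 0) ∧ φ 0 = 0 ∧
    IntervalIntegrable (fun t => φ t / t) volume 0 1 ∧
    ∀ x y, |p x - p y| ≤ φ (dist x y)

/-- The Markov kernel `κ x = ∑ ℓ, p ℓ x • δ_{W ℓ x}` of an iterated random function given by
maps `W ℓ` chosen with place-dependent probabilities `p ℓ`. -/
def IFSKernel {X : Type*} [MeasurableSpace X] {L : ℕ}
    (p : Fin L → X → ℝ) (W : Fin L → X → X) (x : X) : Measure X :=
  ∑ ℓ, ENNReal.ofReal (p ℓ x) • Measure.dirac (W ℓ x)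

/-- A measure `μ` is invariant for the kernel `κ` if `μ.bind κ = μ`. -/
def Invariant {X : Type*} [MeasurableSpace X] (κ : X → Measure X) (μ : Measure X) : Prop :=
  μ.bind κ = μ

/-- A measure `μ` is attractive for the kernel `κ` if for every Borel probability measure `ν`,
the iterates `ν, ν.bind κ, (ν.bind κ).bind κ, …` converge weakly to `μ`. -/
def Attractive {X : Type*} [MeasurableSpace X] [TopologicalSpace X]
    (κ : X → Measure X) (μ : Measure X) : Prop :=
  ∀ ν : Measure X, IsProbabilityMeasure ν →
    ∀ f : BoundedContinuousFunction X ℝ,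
      Tendsto (fun k => ∫ x, f x ∂((fun m : Measure X => m.bind κ)^[k] ν))
        atTop (𝓝 (∫ x, f x ∂μ))

/-- The index set of the augmented state in Proposition 1: the states of the agents of the
two driver populations followed by the states of the two controllers. -/
abbrev Idx4 (N₁ N₂ : ℕ) (n₁ : Fin N₁ → ℕ) (n₂ : Fin N₂ → ℕ) (d₃ d₄ : ℕ) : Type :=
  ((i : Fin N₁) × Fin (n₁ i)) ⊕ (((i : Fin N₂) × Fin (n₂ i)) ⊕ (Fin d₃ ⊕ Fin d₄))

/-- The block an index belongs to, for the four-block decomposition of Proposition 1. -/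
def blk4 {N₁ N₂ : ℕ} {n₁ : Fin N₁ → ℕ} {n₂ : Fin N₂ → ℕ} {d₃ d₄ : ℕ} :
    Idx4 N₁ N₂ n₁ n₂ d₃ d₄ → ℕ :=
  Sum.elim (fun _ => 0) (Sum.elim (fun _ => 1) (Sum.elim (fun _ => 2) (fun _ => 3)))


lemma schur_ker {ι : Type*} [Fintype ι] [DecidableEq ι] {A : Matrix ι ι ℝ} (h : IsSchur A)
    {z : ℂ} (hz : 1 ≤ ‖z‖) (v : ι → ℂ) (hv : ∀ i, ∑ j, (A i j : ℂ) * v j = z * v i) : v = 0 := by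
  by_contra hne
  have h1 : z ∈ spectrum ℂ (A.map (fun x : ℝ => (x : ℂ))) := by
    rw [spectrum.mem_iff, Matrix.isUnit_iff_isUnit_det, isUnit_iff_ne_zero, not_not]
    apply Matrix.exists_mulVec_eq_zero_iff.1
    refine ⟨v, hne, ?_⟩
    rw [Matrix.sub_mulVec]
    ext i
    have := hv i
    simp [Matrix.mulVec, dotProduct, Matrix.algebraMap_eq_diagonal, Matrix.diagonal_apply] 
    rw [this]; ring
  exact absurd (h z h1) (not_lt.2 hz)

lemma schur_of_ker {ι : Type*} [Fintype ι] [DecidableEq ι] {A : Matrix ι ι ℝ} 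
    (h : ∀ z : ℂ, 1 ≤ ‖z‖ → ∀ v : ι → ℂ, (∀ i, ∑ j, (A i j : ℂ) * v j = z * v i) → v = 0) :
    IsSchur A := by
  intro z hz
  by_contra hlt
  rw [spectrum.mem_iff, Matrix.isUnit_iff_isUnit_det, isUnit_iff_ne_zero, not_not] at hz
  obtain ⟨v, hv0, hv⟩ := Matrix.exists_mulVec_eq_zero_iff.2 hz
  refine hv0 (h z (not_lt.1 hlt) v fun i => ?_)
  have := congrFun hv i
  rw [Matrix.sub_mulVec] at this
  simp [Matrix.mulVec, dotProduct, Matrix.algebraMap_eq_diagonal, Matrix.diagonal_apply] at this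
  rw [sub_eq_zero] at this
  exact this.symm

lemma bd_ker {N : ℕ} {n : Fin N → ℕ} {A : ∀ i : Fin N, Matrix (Fin (n i)) (Fin (n i)) ℝ}
    (h : ∀ i, IsSchur (A i)) : IsSchur (Matrix.blockDiagonal' A) := by
  refine schur_of_ker fun z hz v hv => ?_
  ext ⟨i, a⟩
  have : (fun b => v ⟨i, b⟩) = 0 := by
    apply schur_ker (h i) hz
    intro a
    rw [← hv ⟨i, a⟩, Fintype.sum_sigma, Finset.sum_eq_single i]
    · simp
    · intro j _ hj
      simp [Matrix.blockDiagonal'_apply_ne _ _ _ (Ne.symm hj)]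
    · simp
  exact congrFun this a

lemma schur4 {N₁ N₂ : ℕ} {n₁ : Fin N₁ → ℕ} {n₂ : Fin N₂ → ℕ} {d₃ d₄ : ℕ}
    (A₁ : ∀ i : Fin N₁, Matrix (Fin (n₁ i)) (Fin (n₁ i)) ℝ)
    (A₂ : ∀ i : Fin N₂, Matrix (Fin (n₂ i)) (Fin (n₂ i)) ℝ)
    (Ac₁ : Matrix (Fin d₃) (Fin d₃) ℝ) (Ac₂ : Matrix (Fin d₄) (Fin d₄) ℝ)
    (hA₁ : ∀ i, IsSchur (A₁ i)) (hA₂ : ∀ i, IsSchur (A₂ i))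
    (hAc₁ : IsSchur Ac₁) (hAc₂ : IsSchur Ac₂)
    (𝒜 : Matrix (Idx4 N₁ N₂ n₁ n₂ d₃ d₄) (Idx4 N₁ N₂ n₁ n₂ d₃ d₄) ℝ)
    (hlower : ∀ i j, blk4 i < blk4 j → 𝒜 i j = 0)
    (hD₁ : ∀ a b, 𝒜 (Sum.inl a) (Sum.inl b) = Matrix.blockDiagonal' A₁ a b)
    (hD₂ : ∀ a b, 𝒜 (Sum.inr (Sum.inl a)) (Sum.inr (Sum.inl b)) = Matrix.blockDiagonal' A₂ a b)
    (hD₃ : ∀ a b, 𝒜 (Sum.inr (Sum.inr (Sum.inl a))) (Sum.inr (Sum.inr (Sum.inl b))) = Ac₁ a b)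
    (hD₄ : ∀ a b, 𝒜 (Sum.inr (Sum.inr (Sum.inr a))) (Sum.inr (Sum.inr (Sum.inr b))) = Ac₂ a b) :
    IsSchur 𝒜 := by
  refine schur_of_ker fun z hz v hv => ?_
  have z12 : ∀ a b, 𝒜 (Sum.inl a) (Sum.inr b) = 0 := fun a b => hlower _ _ (by
    rcases b with b | b | b <;> simp [blk4])
  have z23 : ∀ a b, 𝒜 (Sum.inr (Sum.inl a)) (Sum.inr (Sum.inr b)) = 0 := fun a b => hlower _ _ (by
    rcases b with b | b <;> simp [blk4])
  have z34 : ∀ a b, 𝒜 (Sum.inr (Sum.inr (Sum.inl a))) (Sum.inr (Sum.inr (Sum.inr b))) = 0 :=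
    fun a b => hlower _ _ (by simp [blk4])
  have v1 : (fun a => v (Sum.inl a)) = 0 := by
    apply schur_ker (bd_ker hA₁) hz
    intro a
    rw [← hv (Sum.inl a), Fintype.sum_sum_type]
    simp only [z12, hD₁]; simp
  have v1' : ∀ a, v (Sum.inl a) = 0 := fun a => congrFun v1 a
  have v2 : (fun a => v (Sum.inr (Sum.inl a))) = 0 := by
    apply schur_ker (bd_ker hA₂) hz
    intro a
    rw [← hv (Sum.inr (Sum.inl a)), Fintype.sum_sum_type, Fintype.sum_sum_type]
    simp only [z23, hD₂, v1']; simp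
  have v2' : ∀ a, v (Sum.inr (Sum.inl a)) = 0 := fun a => congrFun v2 a
  have v3 : (fun a => v (Sum.inr (Sum.inr (Sum.inl a)))) = 0 := by
    apply schur_ker hAc₁ hz
    intro a
    rw [← hv (Sum.inr (Sum.inr (Sum.inl a))), Fintype.sum_sum_type, Fintype.sum_sum_type,
      Fintype.sum_sum_type]
    simp only [z34, hD₃, v1', v2']; simp
  have v3' : ∀ a, v (Sum.inr (Sum.inr (Sum.inl a))) = 0 := fun a => congrFun v3 a
  have v4 : (fun a => v (Sum.inr (Sum.inr (Sum.inr a)))) = 0 := by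
    apply schur_ker hAc₂ hz
    intro a
    rw [← hv (Sum.inr (Sum.inr (Sum.inr a))), Fintype.sum_sum_type, Fintype.sum_sum_type,
      Fintype.sum_sum_type]
    simp only [hD₄, v1', v2', v3']; simp
  ext i
  rcases i with a | a | a | a
  · exact v1' a
  · exact v2' a
  · exact v3' a
  · exact congrFun v4 a

section
attribute [local instance] Matrix.linftyOpNormedRing Matrix.linftyOpNormedAlgebra

lemma schur_pow_aux {ι : Type*} [Fintype ι] [DecidableEq ι] [Nonempty ι] {A : Matrix ι ι ℝ}
    (h : IsSchur A) : ∃ ρ : ℝ, 0 < ρ ∧ ρ < 1 ∧ ∃ C : ℝ, ∀ n i j, |(A ^ n) i j| ≤ C * ρ ^ n := by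
  set B : Matrix ι ι ℂ := A.map (fun x : ℝ => (x : ℂ)) with hB
  have hr : spectralRadius ℂ B < ((1 : NNReal) : ENNReal) := by
    apply spectrum.spectralRadius_lt_of_forall_lt
    intro k hk
    exact_mod_cast h k hk
  obtain ⟨r, hr1, hr2⟩ := ENNReal.lt_iff_exists_nnreal_btwn.1 hr
  have hr2' : r < 1 := by exact_mod_cast hr2
  have hrpos : 0 < r := by
    have := lt_of_le_of_lt (zero_le) hr1
    exact_mod_cast this
  have hev := (spectrum.pow_nnnorm_pow_one_div_tendsto_nhds_spectralRadius B).eventually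
    (gt_mem_nhds hr1)
  have hev2 : ∀ᶠ n : ℕ in atTop, ‖B ^ n‖ ≤ (r : ℝ) ^ n := by
    filter_upwards [hev, eventually_gt_atTop 0] with n hn hn0
    have hn0' : (0 : ℝ) < n := by exact_mod_cast hn0
    have h2 : ((‖B ^ n‖₊ : NNReal) : ENNReal) ≤ (r : ENNReal) ^ (n : ℝ) := by
      rw [one_div] at hn
      exact (ENNReal.rpow_inv_le_iff hn0').1 hn.le
    rw [ENNReal.rpow_natCast] at h2
    have h3 : ‖B ^ n‖₊ ≤ r ^ n := by exact_mod_cast h2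
    exact_mod_cast h3
  obtain ⟨n0, hn0⟩ := eventually_atTop.1 hev2
  have hrp : (0 : ℝ) < r := by exact_mod_cast hrpos
  refine ⟨r, hrp, by exact_mod_cast hr2', 1 + ∑ k ∈ Finset.range n0, ‖B ^ k‖ / (r : ℝ) ^ k, ?_⟩
  intro n i j
  have hent : |(A ^ n) i j| ≤ ‖B ^ n‖ := by
    have e1 : B ^ n = (A ^ n).map (fun x : ℝ => (x : ℂ)) := by
      have := (Matrix.map_pow A Complex.ofRealHom n)
      exact this.symm
    have e2 : |(A ^ n) i j| = ‖(B ^ n) i j‖ := by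
      rw [e1]; simp
    rw [e2]
    have h3 : ‖(B ^ n) i j‖₊ ≤ ‖B ^ n‖₊ := by
      rw [Matrix.linfty_opNNNorm_def]
      calc ‖(B ^ n) i j‖₊ ≤ ∑ j, ‖(B ^ n) i j‖₊ := 
            Finset.single_le_sum (f := fun j => ‖(B ^ n) i j‖₊) (fun _ _ => zero_le) (Finset.mem_univ j)
        _ ≤ _ := Finset.le_sup (f := fun i => ∑ j, ‖(B ^ n) i j‖₊) (Finset.mem_univ i)
    exact_mod_cast h3
  refine hent.trans ?_
  have hsn : 0 ≤ ∑ k ∈ Finset.range n0, ‖B ^ k‖ / (r : ℝ) ^ k :=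
    Finset.sum_nonneg fun k _ => by positivity
  have hpn : 0 < (r : ℝ) ^ n := by positivity
  rcases le_or_gt n0 n with hn | hn
  · have := hn0 n hn
    nlinarith [mul_nonneg hsn hpn.le]
  · have : ‖B ^ n‖ / (r : ℝ) ^ n ≤ ∑ k ∈ Finset.range n0, ‖B ^ k‖ / (r : ℝ) ^ k :=
      Finset.single_le_sum (f := fun k => ‖B ^ k‖ / (r : ℝ) ^ k) (fun k _ => by positivity)
        (Finset.mem_range.2 hn)
    rw [div_le_iff₀ hpn] at this
    nlinarith
end

lemma schur_pow {ι : Type*} [Fintype ι] [DecidableEq ι] {A : Matrix ι ι ℝ}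
    (h : IsSchur A) : ∃ ρ : ℝ, 0 < ρ ∧ ρ < 1 ∧ ∃ C : ℝ, ∀ n : ℕ, ∀ z : EuclideanSpace ℝ ι,
      ‖((Matrix.toEuclideanLin A) ^ n) z‖ ≤ C * ρ ^ n * ‖z‖ := by
  rcases isEmpty_or_nonempty ι with hι | hι
  · refine ⟨1/2, by norm_num, by norm_num, 0, fun n z => ?_⟩
    rw [Subsingleton.elim z 0]; simp
  obtain ⟨ρ, h0, h1, C, hC⟩ := schur_pow_aux h
  refine ⟨ρ, h0, h1, Fintype.card ι * (Fintype.card ι * C), fun n z => ?_⟩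
  have e : ∀ n : ℕ, ∀ z, ((Matrix.toEuclideanLin A) ^ n) z = Matrix.toEuclideanLin (A ^ n) z := by
    intro n
    induction n with
    | zero => intro z; ext i; simp
    | succ n ih => 
      intro z
      rw [pow_succ, Module.End.mul_apply, ih, pow_succ]
      ext i
      simp
  rw [e]
  have hent : ∀ i, ‖(Matrix.toEuclideanLin (A ^ n) z) i‖ ≤ Fintype.card ι * C * ρ ^ n * ‖z‖ := by
    intro i
    have : (Matrix.toEuclideanLin (A ^ n) z) i = ∑ j, (A ^ n) i j * z j := rfl
    rw [this]
    calc _ ≤ ∑ j, ‖(A ^ n) i j * z j‖ := norm_sum_le _ _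
      _ ≤ ∑ j : ι, C * ρ ^ n * ‖z‖ := by
        apply Finset.sum_le_sum
        intro j _
        rw [norm_mul]
        have h1 := hC n i j
        have h2 := PiLp.norm_apply_le z j
        exact mul_le_mul h1 h2 (norm_nonneg _) ((abs_nonneg _).trans h1)
      _ = _ := by simp; ring
  set w := Matrix.toEuclideanLin (A ^ n) z
  have : ‖w‖ ≤ ∑ i, ‖w i‖ := by
    have e : w = ∑ i, EuclideanSpace.single i (w i) := by
      ext j; simp [Finset.sum_apply, Pi.single_apply]
    calc ‖w‖ = ‖∑ i, EuclideanSpace.single i (w i)‖ := by rw [← e]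
      _ ≤ ∑ i, ‖EuclideanSpace.single i (w i)‖ := norm_sum_le _ _
      _ = _ := by simp
  calc ‖w‖ ≤ ∑ i, ‖w i‖ := this
    _ ≤ ∑ i : ι, Fintype.card ι * C * ρ ^ n * ‖z‖ := Finset.sum_le_sum fun i _ => hent i
    _ = _ := by simp; ring

lemma adapted {E : Type*} [NormedAddCommGroup E] [NormedSpace ℝ E] (T : E →ₗ[ℝ] E) {ρ C : ℝ}
    (h0 : 0 < ρ) (h : ∀ n : ℕ, ∀ z, ‖(T ^ n) z‖ ≤ C * ρ ^ n * ‖z‖) :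
    ∃ N : E → ℝ, (∀ z, ‖z‖ ≤ N z) ∧ (∀ x y, N (x + y) ≤ N x + N y) ∧ (∀ z, N (-z) = N z) ∧
      (∀ z, N (T z) ≤ ρ * N z) ∧ N 0 = 0 ∧ ∀ z, N z ≤ C * ‖z‖ := by
  have hb : ∀ z, BddAbove (Set.range fun n : ℕ => ‖(T ^ n) z‖ / ρ ^ n) := by
    intro z
    refine ⟨C * ‖z‖, ?_⟩
    rintro _ ⟨n, rfl⟩
    have hp : 0 < ρ ^ n := by positivity
    simp only
    rw [div_le_iff₀ hp]
    linarith [h n z]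
  refine ⟨fun z => ⨆ n : ℕ, ‖(T ^ n) z‖ / ρ ^ n, ?_, ?_, ?_, ?_, ?_, ?_⟩
  · intro z
    simpa using le_ciSup (hb z) 0
  · intro x y
    apply ciSup_le
    intro n
    have hp : 0 < ρ ^ n := by positivity
    calc ‖(T ^ n) (x + y)‖ / ρ ^ n ≤ (‖(T ^ n) x‖ + ‖(T ^ n) y‖) / ρ ^ n := by
          rw [map_add]; gcongr; exact norm_add_le _ _
      _ = ‖(T ^ n) x‖ / ρ ^ n + ‖(T ^ n) y‖ / ρ ^ n := add_div _ _ _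
      _ ≤ _ := add_le_add (le_ciSup (hb x) n) (le_ciSup (hb y) n)
  · intro z; simp
  · intro z
    apply ciSup_le
    intro n
    have := le_ciSup (hb z) (n + 1)
    rw [pow_succ, Module.End.mul_apply, pow_succ] at this
    calc _ = ρ * (‖(T ^ n) (T z)‖ / (ρ ^ n * ρ)) := by field_simp
      _ ≤ _ := by gcongr
  · simp
  · intro z
    apply ciSup_le
    intro n
    have hp : 0 < ρ ^ n := by positivity
    rw [div_le_iff₀ hp]
    linarith [h n z]

lemma dini_nonneg {φ : ℝ → ℝ} (hm : MonotoneOn φ (Set.Ici 0)) (h0 : φ 0 = 0) {t : ℝ} (ht : 0 ≤ t) :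
    0 ≤ φ t := by
  rw [← h0]; exact hm (Set.mem_Ici.2 le_rfl) ht ht

lemma dini_summable_aux {φ : ℝ → ℝ} (hm : MonotoneOn φ (Set.Ici 0)) (h0 : φ 0 = 0)
    (hi : IntervalIntegrable (fun t => φ t / t) volume 0 1) {ρ T : ℝ} (hρ : 0 < ρ) (hρ1 : ρ < 1)
    (hT : 0 < T) (hT1 : T ≤ 1) : Summable (fun i : ℕ => φ (ρ ^ (i + 1) * T)) := by
  have hpos : ∀ i : ℕ, 0 < ρ ^ i * T := fun i => by positivity
  have hle1 : ∀ i : ℕ, ρ ^ i * T ≤ 1 := fun i =>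
    mul_le_one₀ (pow_le_one₀ hρ.le hρ1.le) hT.le hT1
  have hsucc : ∀ i : ℕ, ρ ^ (i + 1) * T ≤ ρ ^ i * T := fun i => by
    rw [pow_succ]; nlinarith [hpos i]
  have hint : ∀ a b : ℝ, 0 ≤ a → a ≤ 1 → 0 ≤ b → b ≤ 1 →
      IntervalIntegrable (fun t => φ t / t) volume a b := by
    intro a b ha ha1 hb hb1
    refine hi.mono_set ?_
    rw [Set.uIcc_of_le zero_le_one]
    intro x hx
    rcases Set.mem_uIcc.1 hx with h | h
    · exact ⟨ha.trans h.1, h.2.trans hb1⟩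
    · exact ⟨hb.trans h.1, h.2.trans ha1⟩
  have key : ∀ i : ℕ, (1 - ρ) * φ (ρ ^ (i + 1) * T) ≤
      ∫ t in (ρ ^ (i + 1) * T)..(ρ ^ i * T), φ t / t := by
    intro i
    have hc : ∫ t in (ρ ^ (i + 1) * T)..(ρ ^ i * T), φ (ρ ^ (i + 1) * T) / (ρ ^ i * T) =
        (1 - ρ) * φ (ρ ^ (i + 1) * T) := by
      rw [intervalIntegral.integral_const, smul_eq_mul, pow_succ]
      have := (hpos i).ne'
      have h2 : ρ ^ i ≠ 0 := by positivity
      field_simp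
    rw [← hc]
    apply intervalIntegral.integral_mono_on (hsucc i) (by simp)
      (hint _ _ (hpos _).le (hle1 _) (hpos _).le (hle1 _))
    intro x hx
    have hx0 : 0 < x := (hpos (i+1)).trans_le hx.1
    have := hm (Set.mem_Ici.2 (hpos (i+1)).le) (Set.mem_Ici.2 hx0.le) hx.1
    exact div_le_div₀ (dini_nonneg hm h0 hx0.le) this hx0 hx.2
  apply summable_of_sum_range_le (c := (∫ t in (0:ℝ)..1, φ t / t) / (1 - ρ))
  · intro i; exact dini_nonneg hm h0 (hpos _).le
  · intro n
    rw [le_div_iff₀ (by linarith), Finset.sum_mul]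
    have hadj : ∑ k ∈ Finset.range n, ∫ t in (ρ ^ k * T)..(ρ ^ (k + 1) * T), φ t / t =
        ∫ t in (ρ ^ 0 * T)..(ρ ^ n * T), φ t / t :=
      intervalIntegral.sum_integral_adjacent_intervals (a := fun k => ρ ^ k * T)
        (fun k _ => hint _ _ (hpos _).le (hle1 _) (hpos _).le (hle1 _))
    calc ∑ i ∈ Finset.range n, φ (ρ ^ (i + 1) * T) * (1 - ρ) 
        ≤ ∑ k ∈ Finset.range n, ∫ t in (ρ ^ (k + 1) * T)..(ρ ^ k * T), φ t / t := by
          apply Finset.sum_le_sum; intro i _; rw [mul_comm]; exact key i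
      _ = - ∑ k ∈ Finset.range n, ∫ t in (ρ ^ k * T)..(ρ ^ (k + 1) * T), φ t / t := by
          rw [← Finset.sum_neg_distrib]
          apply Finset.sum_congr rfl; intro i _; rw [intervalIntegral.integral_symm]
      _ = ∫ t in (ρ ^ n * T)..(ρ ^ 0 * T), φ t / t := by
          rw [hadj, ← intervalIntegral.integral_symm]
      _ ≤ _ := by
          apply intervalIntegral.integral_mono_interval (hpos n).le _ (hle1 0) _ hi
          · rw [pow_zero]; nlinarith [pow_le_one₀ (n := n) hρ.le hρ1.le]
          · refine (ae_restrict_mem measurableSet_Ioc).mono fun x hx => ?_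
            exact div_nonneg (dini_nonneg hm h0 hx.1.le) hx.1.le

lemma dini_summable {φ : ℝ → ℝ} (hm : MonotoneOn φ (Set.Ici 0)) (h0 : φ 0 = 0)
    (hi : IntervalIntegrable (fun t => φ t / t) volume 0 1) {ρ : ℝ} (hρ : 0 < ρ) (hρ1 : ρ < 1)
    (T : ℝ) (hT : 0 ≤ T) : Summable (fun i : ℕ => φ (ρ ^ i * T)) := by
  rcases hT.eq_or_lt with rfl | hT
  · simp [h0, summable_zero]
  obtain ⟨m, hm1⟩ := exists_pow_lt_of_lt_one (y := ρ) (inv_pos.2 hT) hρ1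
  have h1 : ρ ^ m * T ≤ 1 := by
    have := mul_le_mul_of_nonneg_right hm1.le hT.le
    rwa [inv_mul_cancel₀ hT.ne'] at this
  have := dini_summable_aux hm h0 hi hρ hρ1 (T := ρ ^ m * T) (by positivity) h1
  rw [← summable_nat_add_iff (1 + m)]
  refine this.congr fun i => ?_
  congr 1; ring

lemma dini_continuous {X : Type*} [PseudoMetricSpace X] {p : X → ℝ} (h : DiniContinuous p) :
    Continuous p := by
  obtain ⟨φ, hm, h0, hi, hp⟩ := h
  have hs := (dini_summable hm h0 hi (ρ := 1/2) (by norm_num) (by norm_num) 1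
    zero_le_one).tendsto_atTop_zero
  rw [Metric.continuous_iff]
  intro x ε hε
  obtain ⟨i, hlt⟩ := (hs.eventually (gt_mem_nhds hε)).exists
  refine ⟨(1/2)^i * 1, by positivity, fun y hy => ?_⟩
  rw [Real.dist_eq]
  exact ((hp y x).trans (hm dist_nonneg (Set.mem_Ici.2 (by positivity)) hy.le)).trans_lt hlt

/-- transfer operator -/
def trOp {X : Type*} {L : ℕ} (p : Fin L → X → ℝ) (W : Fin L → X → X) (f : X → ℝ) (x : X) : ℝ :=
  ∑ ℓ, p ℓ x * f (W ℓ x)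

lemma exists_lo {X : Type*} {K : Set X} {f : X → ℝ} {D : ℝ} (hK : K.Nonempty)
    (h : ∀ x ∈ K, ∀ y ∈ K, |f x - f y| ≤ D) : ∃ lo, ∀ x ∈ K, lo ≤ f x ∧ f x ≤ lo + D := by
  obtain ⟨x0, hx0⟩ := hK
  have hbd : BddBelow (f '' K) := by
    refine ⟨f x0 - D, ?_⟩
    rintro _ ⟨y, hy, rfl⟩
    have := (abs_le.1 (h x0 hx0 y hy)).2
    linarith
  refine ⟨sInf (f '' K), fun x hx => ⟨csInf_le hbd ⟨x, hx, rfl⟩, ?_⟩⟩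
  have : f x - D ≤ sInf (f '' K) := by
    apply le_csInf (Set.image_nonempty.2 ⟨x0, hx0⟩)
    rintro _ ⟨y, hy, rfl⟩
    have := (abs_le.1 (h x hx y hy)).2
    linarith
  linarith

lemma one_step {X : Type*} {L : ℕ} {p : Fin L → X → ℝ} {W : Fin L → X → X}
    (hp0 : ∀ ℓ x, 0 ≤ p ℓ x) (hps : ∀ x, ∑ ℓ, p ℓ x = 1) {K : Set X}
    (hWK : ∀ ℓ, ∀ x ∈ K, W ℓ x ∈ K) {f : X → ℝ} {D H s : ℝ}
    (hD : ∀ x ∈ K, ∀ y ∈ K, |f x - f y| ≤ D) (hHD : H ≤ D) {x y : X} (hx : x ∈ K) (hy : y ∈ K)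
    (hH : ∀ ℓ, |f (W ℓ x) - f (W ℓ y)| ≤ H) (hs : 1 - ∑ ℓ, min (p ℓ x) (p ℓ y) ≤ s) :
    |trOp p W f x - trOp p W f y| ≤ D - (1 - s) * (D - H) := by
  -- one-sided
  have main : ∀ x y : X, x ∈ K → y ∈ K → (∀ ℓ, |f (W ℓ x) - f (W ℓ y)| ≤ H) →
      1 - ∑ ℓ, min (p ℓ x) (p ℓ y) ≤ s →
      trOp p W f x - trOp p W f y ≤ D - (1 - s) * (D - H) := by
    intro x y hx hy hH hs
    obtain ⟨lo, hlo⟩ := exists_lo ⟨x, hx⟩ hD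
    have e : trOp p W f x - trOp p W f y ≤ ∑ ℓ, (min (p ℓ x) (p ℓ y) * H +
        ((p ℓ x - min (p ℓ x) (p ℓ y)) * (lo + D) - (p ℓ y - min (p ℓ x) (p ℓ y)) * lo)) := by
      unfold trOp
      rw [← Finset.sum_sub_distrib]
      apply Finset.sum_le_sum
      intro ℓ _
      have h1 := (abs_le.1 (hH ℓ)).2
      have h2 := (hlo _ (hWK ℓ x hx)).2
      have h3 := (hlo _ (hWK ℓ y hy)).1
      have m0 : 0 ≤ min (p ℓ x) (p ℓ y) := le_min (hp0 _ _) (hp0 _ _)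
      have m1 : 0 ≤ p ℓ x - min (p ℓ x) (p ℓ y) := sub_nonneg.2 (min_le_left _ _)
      have m2 : 0 ≤ p ℓ y - min (p ℓ x) (p ℓ y) := sub_nonneg.2 (min_le_right _ _)
      generalize min (p ℓ x) (p ℓ y) = m at *
      nlinarith [mul_le_mul_of_nonneg_left h1 m0, mul_le_mul_of_nonneg_left h2 m1,
        mul_le_mul_of_nonneg_left h3 m2]
    have e2 : ∑ ℓ, (min (p ℓ x) (p ℓ y) * H +
        ((p ℓ x - min (p ℓ x) (p ℓ y)) * (lo + D) - (p ℓ y - min (p ℓ x) (p ℓ y)) * lo)) =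
        (∑ ℓ, min (p ℓ x) (p ℓ y)) * H + (1 - ∑ ℓ, min (p ℓ x) (p ℓ y)) * D := by
      rw [Finset.sum_add_distrib, Finset.sum_sub_distrib, ← Finset.sum_mul, ← Finset.sum_mul,
        ← Finset.sum_mul, Finset.sum_sub_distrib, Finset.sum_sub_distrib, hps, hps]
      ring
    rw [e2] at e
    nlinarith [mul_le_mul_of_nonneg_right hs (sub_nonneg.2 hHD)]
  rw [abs_le]
  constructor
  · have := main y x hy hx (fun ℓ => by rw [abs_sub_comm]; exact hH ℓ)
      (by simpa only [min_comm] using hs)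
    linarith
  · exact main x y hx hy hH hs

/-- structure of hypotheses on a forward invariant set -/
lemma osc_step {X : Type*} {L : ℕ} {p : Fin L → X → ℝ} {W : Fin L → X → X}
    (hp0 : ∀ ℓ x, 0 ≤ p ℓ x) (hps : ∀ x, ∑ ℓ, p ℓ x = 1) {K : Set X}
    (hWK : ∀ ℓ, ∀ x ∈ K, W ℓ x ∈ K) {f : X → ℝ} {D : ℝ}
    (hD : ∀ x ∈ K, ∀ y ∈ K, |f x - f y| ≤ D) :
    ∀ n : ℕ, ∀ x ∈ K, ∀ y ∈ K, |(trOp p W)^[n] f x - (trOp p W)^[n] f y| ≤ D := by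
  intro n
  induction n with
  | zero => exact hD
  | succ n ih =>
    intro x hx y hy
    rw [Function.iterate_succ_apply']
    have := one_step hp0 hps hWK ih le_rfl hx hy (fun ℓ => ih _ (hWK ℓ x hx) _ (hWK ℓ y hy)) le_rfl
    simpa using this

lemma n_step {X : Type*} {L : ℕ} {p : Fin L → X → ℝ} {W : Fin L → X → X}
    (hp0 : ∀ ℓ x, 0 ≤ p ℓ x) (hps : ∀ x, ∑ ℓ, p ℓ x = 1) {K : Set X}
    (hWK : ∀ ℓ, ∀ x ∈ K, W ℓ x ∈ K) (d : X → X → ℝ) {ρ : ℝ} (hρ : 0 < ρ)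
    (hd : ∀ ℓ x y, d (W ℓ x) (W ℓ y) ≤ ρ * d x y) (S : ℝ → ℝ) (hS1 : ∀ t, S t ≤ 1)
    (hS : ∀ x y t, 0 ≤ t → d x y ≤ t → 1 - ∑ ℓ, min (p ℓ x) (p ℓ y) ≤ S t)
    {f : X → ℝ} {D H : ℝ}
    (hD : ∀ x ∈ K, ∀ y ∈ K, |f x - f y| ≤ D) (hHD : H ≤ D) :
    ∀ n : ℕ, ∀ t, 0 ≤ t → (∀ u ∈ K, ∀ v ∈ K, d u v ≤ ρ ^ n * t → |f u - f v| ≤ H) →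
      ∀ x ∈ K, ∀ y ∈ K, d x y ≤ t → |(trOp p W)^[n] f x - (trOp p W)^[n] f y| ≤
        D - (∏ i ∈ Finset.range n, (1 - S (ρ ^ i * t))) * (D - H) := by
  intro n
  induction n with
  | zero => 
    intro t ht hH x hx y hy hxy
    simpa using hH x hx y hy (by simpa using hxy)
  | succ n ih =>
    intro t ht hH x hx y hy hxy
    rw [Function.iterate_succ_apply']
    have hpr : 0 ≤ ∏ i ∈ Finset.range n, (1 - S (ρ ^ i * (ρ * t))) :=
      Finset.prod_nonneg fun i _ => sub_nonneg.2 (hS1 _)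
    have := one_step (s := S t) hp0 hps hWK (osc_step hp0 hps hWK hD n)
      (H := D - (∏ i ∈ Finset.range n, (1 - S (ρ ^ i * (ρ * t)))) * (D - H))
      (by nlinarith [mul_nonneg hpr (sub_nonneg.2 hHD)]) hx hy (fun ℓ => by
        apply ih (ρ * t) (by positivity) _ _ (hWK ℓ x hx) _ (hWK ℓ y hy)
        · exact (hd ℓ x y).trans (by gcongr)
        · intro u hu v hv huv
          exact hH u hu v hv (by rw [pow_succ]; linarith)) (hS x y t ht hxy)
    refine this.trans (le_of_eq ?_)
    rw [Finset.prod_range_succ']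
    have e : ∀ i, ρ ^ i * (ρ * t) = ρ ^ (i + 1) * t := fun i => by ring
    simp only [e]
    simp
    ring

lemma prod_lower (s : ℕ → ℝ) (h0 : ∀ i, 0 ≤ s i) (h1 : ∀ i, s i ≤ 1) (n : ℕ) :
    1 - ∑ i ∈ Finset.range n, s i ≤ ∏ i ∈ Finset.range n, (1 - s i) := by
  induction n with
  | zero => simp
  | succ n ih =>
    rw [Finset.sum_range_succ, Finset.prod_range_succ]
    have hp : ∏ i ∈ Finset.range n, (1 - s i) ≤ 1 :=
      Finset.prod_le_one (fun i _ => sub_nonneg.2 (h1 i)) (fun i _ => by linarith [h0 i])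
    nlinarith [h0 n, h1 n]

/-- tail estimate -/
lemma prod_tail (s : ℕ → ℝ) (h0 : ∀ i, 0 ≤ s i) (h1 : ∀ i, s i ≤ 1) (hs : Summable s) {ε : ℝ}
    (hε : 0 < ε) : ∃ m0, ∀ m ≥ m0, ∀ n, 1 - ε ≤ ∏ i ∈ Finset.range n, (1 - s (i + m)) := by
  have ht := tendsto_sum_nat_add s
  obtain ⟨m0, hm0⟩ := eventually_atTop.1 (ht.eventually (gt_mem_nhds hε))
  refine ⟨m0, fun m hm n => le_trans ?_ (prod_lower (fun i => s (i + m)) (fun i => h0 _) (fun i => h1 _) n)⟩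
  have := ((summable_nat_add_iff m).2 hs).sum_le_tsum (Finset.range n) (fun i _ => h0 _)
  linarith [hm0 m hm]

lemma prod_pos_lower (s : ℕ → ℝ) {δ : ℝ} (hδ : 0 < δ) (h0 : ∀ i, 0 ≤ s i) (h1 : ∀ i, s i ≤ 1 - δ)
    (hs : Summable s) : ∃ c, 0 < c ∧ c ≤ 1 ∧ ∀ n, c ≤ ∏ i ∈ Finset.range n, (1 - s i) := by
  have h1' : ∀ i, s i ≤ 1 := fun i => by linarith [h1 i]
  obtain ⟨m, hm⟩ := prod_tail s h0 h1' hs (ε := 1/2) (by norm_num)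
  have hm := hm m le_rfl
  have hδ1 : δ ≤ 1 := by linarith [h0 0, h1 0]
  have hpw : ∀ n, δ ^ n ≤ ∏ i ∈ Finset.range n, (1 - s i) := by
    intro n
    calc δ ^ n = ∏ i ∈ Finset.range n, δ := by simp
      _ ≤ _ := Finset.prod_le_prod (fun _ _ => hδ.le) (fun i _ => by linarith [h1 i])
  have hpm : 0 < δ ^ m := by positivity
  have hpm1 : δ ^ m ≤ 1 := pow_le_one₀ hδ.le hδ1
  refine ⟨δ ^ m * (1/2), by positivity, by linarith, fun n => ?_⟩
  rcases le_or_gt m n with h | h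
  · obtain ⟨k, rfl⟩ := Nat.exists_eq_add_of_le h
    rw [Finset.prod_range_add]
    have h3 := hm k
    simp only [add_comm m]
    exact mul_le_mul (hpw m) (by linarith) (by norm_num) (hpm.le.trans (hpw m))
  · refine le_trans ?_ (hpw n)
    have : δ ^ m ≤ δ ^ n := pow_le_pow_of_le_one hδ.le hδ1 h.le
    linarith

lemma osc_tendsto {X : Type*} {L : ℕ} {p : Fin L → X → ℝ} {W : Fin L → X → X}
    (hp0 : ∀ ℓ x, 0 ≤ p ℓ x) (hps : ∀ x, ∑ ℓ, p ℓ x = 1) {K : Set X}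
    (hWK : ∀ ℓ, ∀ x ∈ K, W ℓ x ∈ K) (d : X → X → ℝ) {ρ : ℝ} (hρ : 0 < ρ) (hρ1 : ρ < 1)
    (hd : ∀ ℓ x y, d (W ℓ x) (W ℓ y) ≤ ρ * d x y) (S : ℝ → ℝ) {δ : ℝ} (hδ : 0 < δ)
    (hS1 : ∀ t, S t ≤ 1 - δ)
    (hS : ∀ x y t, 0 ≤ t → d x y ≤ t → 1 - ∑ ℓ, min (p ℓ x) (p ℓ y) ≤ S t)
    (hS0 : ∀ t, 0 ≤ t → 0 ≤ S t) {T : ℝ} (hT : 0 ≤ T) (hsum : Summable fun i : ℕ => S (ρ ^ i * T))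
    (hKT : ∀ x ∈ K, ∀ y ∈ K, d x y ≤ T)
    {f : X → ℝ} {D0 : ℝ} (hD0 : ∀ x ∈ K, ∀ y ∈ K, |f x - f y| ≤ D0)
    (huc : ∀ ε > 0, ∃ η > 0, ∀ x ∈ K, ∀ y ∈ K, d x y ≤ η → |f x - f y| ≤ ε) :
    ∀ ε > 0, ∃ n0 : ℕ, ∀ n ≥ n0, ∀ x ∈ K, ∀ y ∈ K,
      |(trOp p W)^[n] f x - (trOp p W)^[n] f y| ≤ ε := by
  intro ε hε
  have hS1' : ∀ t, S t ≤ 1 := fun t => by linarith [hS1 t]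
  set D := max D0 ε with hDdef
  have hDε : ε ≤ D := le_max_right _ _
  have hDpos : 0 < D := hε.trans_le hDε
  have hD : ∀ x ∈ K, ∀ y ∈ K, |f x - f y| ≤ D := fun x hx y hy =>
    (hD0 x hx y hy).trans (le_max_left _ _)
  have hs0 : ∀ i : ℕ, 0 ≤ S (ρ ^ i * T) := fun i => hS0 _ (by positivity)
  obtain ⟨η, hη, huc⟩ := huc (ε / 4) (by positivity)
  obtain ⟨m1, hm1⟩ := prod_tail (fun i => S (ρ ^ i * T)) hs0 (fun i => hS1' _) hsum
    (ε := ε / (4 * D)) (by positivity)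
  have hlim : Tendsto (fun m : ℕ => ρ ^ m * T) atTop (𝓝 0) := by
    simpa using (tendsto_pow_atTop_nhds_zero_of_lt_one hρ.le hρ1).mul_const T
  obtain ⟨m2, hm2⟩ := eventually_atTop.1 (hlim.eventually (gt_mem_nhds hη))
  set m := max m1 m2
  -- equicontinuity at scale `ρ ^ m * T`
  have hequi : ∀ n : ℕ, ∀ u ∈ K, ∀ v ∈ K, d u v ≤ ρ ^ m * T →
      |(trOp p W)^[n] f u - (trOp p W)^[n] f v| ≤ ε / 2 := by
    intro n u hu v hv huv
    have h := n_step hp0 hps hWK d hρ hd S hS1' hS hD (H := ε / 4) (by linarith) n (ρ ^ m * T)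
      (by positivity) (fun u hu v hv huv => huc u hu v hv (huv.trans ?_)) u hu v hv huv
    · refine h.trans ?_
      have hq := hm1 m (le_max_left _ _) n
      have e : ∀ i, ρ ^ i * (ρ ^ m * T) = ρ ^ (i + m) * T := fun i => by ring
      simp only [e]
      have h3 : ε / (4 * D) * D = ε / 4 := by field_simp
      have h4 : 0 < ε / (4 * D) := by positivity
      generalize ∏ i ∈ Finset.range n, (1 - S (ρ ^ (i + m) * T)) = Q at *
      have h5 : (1 - ε / (4 * D)) * (D - ε / 4) ≤ Q * (D - ε / 4) :=
        mul_le_mul_of_nonneg_right hq (by linarith)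
      nlinarith
    · have h1 : ρ ^ n ≤ 1 := pow_le_one₀ hρ.le hρ1.le
      have h2 := hm2 m (le_max_right _ _)
      have h3 : 0 ≤ ρ ^ m * T := by positivity
      nlinarith
  obtain ⟨c, hc0, hc1, hc⟩ := prod_pos_lower (fun i => S (ρ ^ i * T)) hδ hs0 (fun i => hS1 _) hsum
  have hgeo : ∀ k : ℕ, ∀ x ∈ K, ∀ y ∈ K,
      |(trOp p W)^[m * k] f x - (trOp p W)^[m * k] f y| ≤ ε / 2 + (1 - c) ^ k * D := by
    intro k
    induction k with
    | zero => 
      intro x hx y hy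
      have := hD x hx y hy
      simp; linarith
    | succ k ih =>
      intro x hx y hy
      have hk : 0 ≤ (1 - c) ^ k * D := mul_nonneg (pow_nonneg (by linarith) _) hDpos.le
      have h := n_step hp0 hps hWK d hρ hd S hS1' hS ih (H := ε / 2) (by linarith) m T hT
        (hequi (m * k)) x hx y hy (hKT x hx y hy)
      rw [show m * (k + 1) = m + m * k by ring, Function.iterate_add_apply]
      refine h.trans ?_
      have := mul_le_mul_of_nonneg_right (hc m) hk
      rw [pow_succ]
      nlinarith
  have hlim2 : Tendsto (fun k : ℕ => (1 - c) ^ k * D) atTop (𝓝 0) := by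
    simpa using (tendsto_pow_atTop_nhds_zero_of_lt_one (by linarith : 0 ≤ 1 - c)
      (by linarith)).mul_const D
  obtain ⟨k, hk⟩ := (hlim2.eventually (gt_mem_nhds (half_pos hε))).exists
  refine ⟨m * k, fun n hn x hx y hy => ?_⟩
  obtain ⟨j, rfl⟩ := Nat.exists_eq_add_of_le hn
  rw [add_comm, Function.iterate_add_apply]
  refine osc_step hp0 hps hWK (fun x hx y hy => (hgeo k x hx y hy).trans ?_) j x hx y hy
  linarith

lemma trOp_mem {X : Type*} {L : ℕ} {p : Fin L → X → ℝ} {W : Fin L → X → X}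
    (hp0 : ∀ ℓ x, 0 ≤ p ℓ x) (hps : ∀ x, ∑ ℓ, p ℓ x = 1) {K : Set X}
    (hWK : ∀ ℓ, ∀ x ∈ K, W ℓ x ∈ K) {f : X → ℝ} {a b : ℝ} (h : ∀ x ∈ K, a ≤ f x ∧ f x ≤ b) 
    (n : ℕ) : ∀ x ∈ K, a ≤ (trOp p W)^[n] f x ∧ (trOp p W)^[n] f x ≤ b := by
  induction n with
  | zero => exact h
  | succ n ih =>
    intro x hx
    rw [Function.iterate_succ_apply']
    constructor
    · calc a = ∑ ℓ, p ℓ x * a := by rw [← Finset.sum_mul, hps, one_mul]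
        _ ≤ _ := Finset.sum_le_sum fun ℓ _ =>
          mul_le_mul_of_nonneg_left (ih _ (hWK ℓ x hx)).1 (hp0 _ _)
    · calc _ ≤ ∑ ℓ, p ℓ x * b := Finset.sum_le_sum fun ℓ _ =>
          mul_le_mul_of_nonneg_left (ih _ (hWK ℓ x hx)).2 (hp0 _ _)
        _ = b := by rw [← Finset.sum_mul, hps, one_mul]

lemma trOp_cauchy {X : Type*} {L : ℕ} {p : Fin L → X → ℝ} {W : Fin L → X → X}
    (hp0 : ∀ ℓ x, 0 ≤ p ℓ x) (hps : ∀ x, ∑ ℓ, p ℓ x = 1) {K : Set X}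
    (hWK : ∀ ℓ, ∀ x ∈ K, W ℓ x ∈ K) {f : X → ℝ}
    (h : ∀ ε > 0, ∃ n0 : ℕ, ∀ n ≥ n0, ∀ x ∈ K, ∀ y ∈ K,
      |(trOp p W)^[n] f x - (trOp p W)^[n] f y| ≤ ε) {x : X} (hx : x ∈ K) :
    ∃ c, Tendsto (fun n => (trOp p W)^[n] f x) atTop (𝓝 c) := by
  apply cauchySeq_tendsto_of_complete
  rw [Metric.cauchySeq_iff']
  intro ε hε
  obtain ⟨n0, hn0⟩ := h (ε / 2) (half_pos hε)
  refine ⟨n0, fun n hn => ?_⟩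
  obtain ⟨j, rfl⟩ := Nat.exists_eq_add_of_le hn
  have hb : ∀ y ∈ K, (trOp p W)^[n0] f x - ε / 2 ≤ (trOp p W)^[n0] f y ∧
      (trOp p W)^[n0] f y ≤ (trOp p W)^[n0] f x + ε / 2 := by
    intro y hy
    have := abs_le.1 (hn0 n0 le_rfl x hx y hy)
    constructor <;> linarith [this.1, this.2]
  have := trOp_mem hp0 hps hWK hb j x hx
  rw [add_comm, Function.iterate_add_apply, Real.dist_eq, abs_lt]
  constructor <;> linarith [this.1, this.2]

section meas
variable {X : Type*} [TopologicalSpace X] [MeasurableSpace X] [BorelSpace X] {L : ℕ}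
  {p : Fin L → X → ℝ} {W : Fin L → X → X}

lemma kernel_measurable (hpc : ∀ ℓ, Continuous (p ℓ)) (hWc : ∀ ℓ, Continuous (W ℓ)) :
    Measurable (IFSKernel p W) := by
  refine Measure.measurable_of_measurable_coe _ fun s hs => ?_
  have : (fun x => IFSKernel p W x s) = fun x => ∑ ℓ, ENNReal.ofReal (p ℓ x) *
      s.indicator 1 (W ℓ x) := by
    ext x
    simp [IFSKernel, Measure.finsetSum_apply, Measure.dirac_apply' _ hs]
  rw [this]
  refine Finset.measurable_sum _ fun ℓ _ => ?_
  exact (hpc ℓ).measurable.ennreal_ofReal.mul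
    ((measurable_one.indicator hs).comp (hWc ℓ).measurable)

lemma kernel_prob (hp0 : ∀ ℓ x, 0 ≤ p ℓ x) (hps : ∀ x, ∑ ℓ, p ℓ x = 1) (x : X) :
    IsProbabilityMeasure (IFSKernel p W x) := by
  constructor
  simp [IFSKernel, Measure.finsetSum_apply]
  rw [← ENNReal.ofReal_sum_of_nonneg (fun ℓ _ => hp0 ℓ x), hps]; simp

lemma kernel_integral (hp0 : ∀ ℓ x, 0 ≤ p ℓ x) {f : X → ℝ} (hf : Continuous f) (x : X) :
    ∫ y, f y ∂(IFSKernel p W x) = trOp p W f x := by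
  have hint : ∀ ℓ, Integrable f (ENNReal.ofReal (p ℓ x) • Measure.dirac (W ℓ x)) := fun ℓ =>
    Integrable.smul_measure (integrable_dirac' hf.stronglyMeasurable (by simp)) ENNReal.ofReal_ne_top
  unfold IFSKernel trOp
  rw [integral_finsetSum_measure (fun ℓ _ => hint ℓ)]
  refine Finset.sum_congr rfl fun ℓ _ => ?_
  rw [integral_smul_measure, integral_dirac' _ _ hf.stronglyMeasurable,
    ENNReal.toReal_ofReal (hp0 ℓ x), smul_eq_mul]

lemma trOp_cont (hpc : ∀ ℓ, Continuous (p ℓ)) (hWc : ∀ ℓ, Continuous (W ℓ)) {f : X → ℝ}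
    (hf : Continuous f) : Continuous (trOp p W f) := by
  unfold trOp; fun_prop

lemma trOp_iter_cont (hpc : ∀ ℓ, Continuous (p ℓ)) (hWc : ∀ ℓ, Continuous (W ℓ)) {f : X → ℝ}
    (hf : Continuous f) (n : ℕ) : Continuous ((trOp p W)^[n] f) := by
  induction n with
  | zero => exact hf
  | succ n ih => rw [Function.iterate_succ_apply']; exact trOp_cont hpc hWc ih

lemma bind_prob (hp0 : ∀ ℓ x, 0 ≤ p ℓ x) (hps : ∀ x, ∑ ℓ, p ℓ x = 1)
    (hpc : ∀ ℓ, Continuous (p ℓ)) (hWc : ∀ ℓ, Continuous (W ℓ)) (ν : Measure X)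
    [IsProbabilityMeasure ν] : IsProbabilityMeasure (ν.bind (IFSKernel p W)) := by
  constructor
  rw [Measure.bind_apply MeasurableSet.univ (kernel_measurable hpc hWc).aemeasurable]
  have := fun x => (kernel_prob (W := W) hp0 hps x).measure_univ
  simp [this]

lemma iter_prob (hp0 : ∀ ℓ x, 0 ≤ p ℓ x) (hps : ∀ x, ∑ ℓ, p ℓ x = 1)
    (hpc : ∀ ℓ, Continuous (p ℓ)) (hWc : ∀ ℓ, Continuous (W ℓ)) (ν : Measure X)
    [hν : IsProbabilityMeasure ν] (n : ℕ) :
    IsProbabilityMeasure ((fun m : Measure X => m.bind (IFSKernel p W))^[n] ν) := by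
  induction n with
  | zero => exact hν
  | succ n ih => rw [Function.iterate_succ_apply']; exact bind_prob hp0 hps hpc hWc _

lemma bind_integral (hp0 : ∀ ℓ x, 0 ≤ p ℓ x) (hps : ∀ x, ∑ ℓ, p ℓ x = 1)
    (hpc : ∀ ℓ, Continuous (p ℓ)) (hWc : ∀ ℓ, Continuous (W ℓ)) (ν : Measure X)
    [IsProbabilityMeasure ν] {f : X → ℝ} (hf : Continuous f) {C : ℝ} (hC : ∀ x, |f x| ≤ C) :
    ∫ x, f x ∂(ν.bind (IFSKernel p W)) = ∫ x, trOp p W f x ∂ν := by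
  have := bind_prob hp0 hps hpc hWc ν
  let κ : ProbabilityTheory.Kernel X X := ⟨IFSKernel p W, kernel_measurable hpc hWc⟩
  have hκ : ProbabilityTheory.IsMarkovKernel κ := ⟨fun x => kernel_prob hp0 hps x⟩
  have hi : Integrable f (ν.bind κ) := by
    have : IsProbabilityMeasure (ν.bind κ) := this
    exact Integrable.of_bound hf.aestronglyMeasurable C (Eventually.of_forall hC)
  have h := ProbabilityTheory.Kernel.integral_comp (κ := ProbabilityTheory.Kernel.const Unit ν)
    (η := κ) (a := ()) (f := f) (by simpa [ProbabilityTheory.Kernel.comp_apply] using hi)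
  simp only [ProbabilityTheory.Kernel.comp_apply, ProbabilityTheory.Kernel.const_apply] at h
  refine h.trans (integral_congr_ae (Eventually.of_forall fun x => kernel_integral hp0 hf x))

lemma iter_bound (hp0 : ∀ ℓ x, 0 ≤ p ℓ x) (hps : ∀ x, ∑ ℓ, p ℓ x = 1) {f : X → ℝ} {C : ℝ}
    (hC : ∀ x, |f x| ≤ C) (n : ℕ) (x : X) : |(trOp p W)^[n] f x| ≤ C := by
  rw [abs_le]
  exact trOp_mem hp0 hps (K := Set.univ) (fun _ _ _ => trivial) (fun x _ => abs_le.1 (hC x)) n x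
    trivial

lemma iter_integral (hp0 : ∀ ℓ x, 0 ≤ p ℓ x) (hps : ∀ x, ∑ ℓ, p ℓ x = 1)
    (hpc : ∀ ℓ, Continuous (p ℓ)) (hWc : ∀ ℓ, Continuous (W ℓ)) (ν : Measure X)
    [IsProbabilityMeasure ν] {f : X → ℝ} (hf : Continuous f) {C : ℝ} (hC : ∀ x, |f x| ≤ C) 
    (n : ℕ) :
    ∫ x, f x ∂((fun m : Measure X => m.bind (IFSKernel p W))^[n] ν) =
      ∫ x, (trOp p W)^[n] f x ∂ν := by
  induction n generalizing f with
  | zero => rfl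
  | succ n ih =>
    have := iter_prob hp0 hps hpc hWc ν n
    rw [Function.iterate_succ_apply', bind_integral hp0 hps hpc hWc _ hf hC,
      ih (trOp_cont hpc hWc hf) (iter_bound hp0 hps hC 1), Function.iterate_succ_apply]

end meas

lemma abstract_main {X : Type*} [MetricSpace X] [MeasurableSpace X] [BorelSpace X]
    {L : ℕ} {p : Fin L → X → ℝ} {W : Fin L → X → X}
    (hp0 : ∀ ℓ x, 0 ≤ p ℓ x) (hps : ∀ x, ∑ ℓ, p ℓ x = 1)
    (hpc : ∀ ℓ, Continuous (p ℓ)) (hWc : ∀ ℓ, Continuous (W ℓ))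
    (hconv : ∀ f : BoundedContinuousFunction X ℝ, ∃ c, ∀ x,
      Tendsto (fun n => (trOp p W)^[n] f x) atTop (𝓝 c))
    {K : Set X} (hK : IsCompact K) (hWK : ∀ ℓ, ∀ x ∈ K, W ℓ x ∈ K) {x0 : X} (hx0 : x0 ∈ K) :
    ∃ μstar : Measure X,
      (IsProbabilityMeasure μstar ∧ Invariant (IFSKernel p W) μstar) ∧
      (∀ μ : Measure X, IsProbabilityMeasure μ → Invariant (IFSKernel p W) μ → μ = μstar) ∧
      Attractive (IFSKernel p W) μstar := by
  choose c hc using hconv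
  have hbd : ∀ (f : BoundedContinuousFunction X ℝ) x, |f x| ≤ ‖f‖ := fun f x => f.norm_coe_le_norm x
  -- attraction
  have hattr : ∀ ν : Measure X, IsProbabilityMeasure ν → ∀ f : BoundedContinuousFunction X ℝ,
      Tendsto (fun k => ∫ x, f x ∂((fun m : Measure X => m.bind (IFSKernel p W))^[k] ν))
        atTop (𝓝 (c f)) := by
    intro ν hν f
    have h1 : Tendsto (fun n => ∫ x, (trOp p W)^[n] f x ∂ν) atTop (𝓝 (∫ _, c f ∂ν)) := by
      apply tendsto_integral_of_dominated_convergence (fun _ => ‖f‖)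
      · intro n; exact (trOp_iter_cont hpc hWc f.continuous n).aestronglyMeasurable
      · exact integrable_const _
      · intro n
        exact Eventually.of_forall fun x => iter_bound hp0 hps (hbd f) n x
      · exact Eventually.of_forall fun x => hc f x
    have h2 : ∫ _, c f ∂ν = c f := by simp
    rw [h2] at h1
    refine h1.congr fun n => ?_
    rw [iter_integral hp0 hps hpc hWc ν f.continuous (hbd f) n]
  -- tightness
  let u : ℕ → ProbabilityMeasure X := fun n =>
    ⟨(fun m : Measure X => m.bind (IFSKernel p W))^[n] (Measure.dirac x0),
      iter_prob hp0 hps hpc hWc _ n⟩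
  have hKm : MeasurableSet K := hK.isClosed.measurableSet
  have hu : ∀ n, ((u n : ProbabilityMeasure X) : Measure X) Kᶜ = 0 := by
    intro n
    change ((fun m : Measure X => m.bind (IFSKernel p W))^[n] (Measure.dirac x0)) Kᶜ = 0
    induction n with
    | zero => simp [Measure.dirac_apply' _ hKm.compl, hx0]
    | succ n ih =>
      rw [Function.iterate_succ_apply', Measure.bind_apply hKm.compl
        (kernel_measurable hpc hWc).aemeasurable]
      refine (lintegral_congr_ae ?_).trans lintegral_zero
      have : ∀ᵐ x ∂((fun m : Measure X => m.bind (IFSKernel p W))^[n] (Measure.dirac x0)), x ∈ K := ih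
      filter_upwards [this] with x hx
      simp [IFSKernel, Measure.finsetSum_apply, Measure.dirac_apply' _ hKm.compl, hWK _ x hx]
  have htight : IsTightMeasureSet {((μ : ProbabilityMeasure X) : Measure X) | μ ∈ Set.range u} := by
    rw [isTightMeasureSet_iff_exists_isCompact_measure_compl_le]
    intro ε _
    refine ⟨K, hK, ?_⟩
    rintro _ ⟨_, ⟨n, rfl⟩, rfl⟩
    rw [hu n]; exact zero_le
  have hcpt := isCompact_closure_of_isTightMeasureSet htight
  obtain ⟨μ, -, hμ⟩ := hcpt.exists_mapClusterPt (f := atTop) (u := u)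
    (tendsto_principal.2 (Eventually.of_forall fun n => subset_closure ⟨n, rfl⟩))
  have hμint : ∀ f : BoundedContinuousFunction X ℝ, ∫ x, f x ∂(μ : Measure X) = c f := by
    intro f
    have hcont : Continuous fun ν : ProbabilityMeasure X => ∫ x, f x ∂(ν : Measure X) := by
      rw [continuous_iff_continuousAt]
      intro ν
      exact (ProbabilityMeasure.tendsto_iff_forall_integral_tendsto.1 tendsto_id) f
    have h1 : MapClusterPt (∫ x, f x ∂(μ : Measure X)) atTop
        (fun n => ∫ x, f x ∂(u n : Measure X)) :=
      hμ.continuousAt_comp hcont.continuousAt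
    have h2 := hattr (Measure.dirac x0) inferInstance f
    have h3 : ClusterPt (∫ x, f x ∂(μ : Measure X)) (𝓝 (c f)) := ClusterPt.mono h1 h2
    have h4 : (𝓝 (∫ x, f x ∂(μ : Measure X)) ⊓ 𝓝 (c f)).NeBot := h3
    exact eq_of_nhds_neBot h4
  have hinv : Invariant (IFSKernel p W) (μ : Measure X) := by
    unfold Invariant
    have := bind_prob hp0 hps hpc hWc (μ : Measure X)
    apply ext_of_forall_integral_eq_of_IsFiniteMeasure
    intro f
    rw [bind_integral hp0 hps hpc hWc _ f.continuous (hbd f)]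
    let g : BoundedContinuousFunction X ℝ := BoundedContinuousFunction.ofNormedAddCommGroup
      (trOp p W f) (trOp_cont hpc hWc f.continuous) ‖f‖ (iter_bound hp0 hps (hbd f) 1)
    have h1 : ∫ x, trOp p W f x ∂(μ : Measure X) = c g := hμint g
    rw [h1, hμint f]
    have h2 := hc g x0
    have h3 := (tendsto_add_atTop_iff_nat 1).2 (hc f x0)
    exact tendsto_nhds_unique h2 h3
  refine ⟨μ, ⟨inferInstance, hinv⟩, ?_, ?_⟩
  · intro ν hν hνi
    apply ext_of_forall_integral_eq_of_IsFiniteMeasure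
    intro f
    rw [hμint f]
    have h1 := hattr ν hν f
    have h2 : ∀ k, (fun m : Measure X => m.bind (IFSKernel p W))^[k] ν = ν := fun k =>
      Function.iterate_fixed (f := fun m : Measure X => m.bind (IFSKernel p W)) hνi k
    simp only [h2] at h1
    exact tendsto_nhds_unique tendsto_const_nhds h1
  · intro ν hν f
    rw [hμint f]
    exact hattr ν hν f

lemma affine_main {E : Type*} [NormedAddCommGroup E] [NormedSpace ℝ E] [FiniteDimensional ℝ E]
    [MeasurableSpace E] [BorelSpace E] (A : E →ₗ[ℝ] E) {ρ C : ℝ} (hρ : 0 < ρ) (hρ1 : ρ < 1)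
    (hA : ∀ n : ℕ, ∀ z, ‖(A ^ n) z‖ ≤ C * ρ ^ n * ‖z‖)
    {L : ℕ} (β : Fin L → E) (W : Fin L → E → E) (hW : ∀ ℓ ξ, W ℓ ξ = A ξ + β ℓ)
    (p : Fin L → E → ℝ) (hp0 : ∀ ℓ x, 0 ≤ p ℓ x) (hpDini : ∀ ℓ, DiniContinuous (p ℓ))
    (hpsum : ∀ x, ∑ ℓ, p ℓ x = 1) (δ : ℝ) (hδ : 0 < δ) (hplb : ∀ ℓ x, δ ≤ p ℓ x) :
    ∃ μstar : Measure E,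
      (IsProbabilityMeasure μstar ∧ Invariant (IFSKernel p W) μstar) ∧
      (∀ μ : Measure E, IsProbabilityMeasure μ → Invariant (IFSKernel p W) μ → μ = μstar) ∧
      Attractive (IFSKernel p W) μstar := by
  obtain ⟨N, hN1, hNadd, hNneg, hNA, hN00, hNC⟩ := adapted A hρ hA
  have hN0 : ∀ z, 0 ≤ N z := fun z => (norm_nonneg z).trans (hN1 z)
  have hAc : Continuous A := A.continuous_of_finiteDimensional
  have hWc : ∀ ℓ, Continuous (W ℓ) := fun ℓ => by
    have : W ℓ = fun ξ => A ξ + β ℓ := funext (hW ℓ)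
    rw [this]; fun_prop
  have hpc : ∀ ℓ, Continuous (p ℓ) := fun ℓ => dini_continuous (hpDini ℓ)
  have : ProperSpace E := FiniteDimensional.proper ℝ E
  -- L nonempty
  have hL : Nonempty (Fin L) := by
    by_contra h
    rw [not_nonempty_iff] at h
    have := hpsum 0
    simp at this
  have hNcont : Continuous N := by
    have hsub : ∀ x y, |N x - N y| ≤ C * ‖x - y‖ := by
      intro x y
      have h1 := hNadd (x - y) y
      have h2 := hNadd (y - x) x
      rw [sub_add_cancel] at h1 h2
      have h3 : N (y - x) = N (x - y) := by rw [← hNneg, neg_sub]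
      have := hNC (x - y)
      rw [abs_le]; constructor <;> linarith
    have : LipschitzWith C.toNNReal N := by
      refine LipschitzWith.of_dist_le_mul fun x y => ?_
      rw [Real.dist_eq, dist_eq_norm]
      exact (hsub x y).trans (mul_le_mul_of_nonneg_right (Real.le_coe_toNNReal C) (norm_nonneg _))
    exact this.continuous
  set B := ∑ ℓ, N (β ℓ) with hB
  have hB0 : 0 ≤ B := Finset.sum_nonneg fun ℓ _ => hN0 _
  have hβB : ∀ ℓ, N (β ℓ) ≤ B := fun ℓ =>
    Finset.single_le_sum (f := fun ℓ => N (β ℓ)) (fun ℓ _ => hN0 _) (Finset.mem_univ ℓ)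
  let K : ℝ → Set E := fun R => {x | N x ≤ R}
  have hKc : ∀ R, IsCompact (K R) := by
    intro R
    refine (isCompact_closedBall (0 : E) R).of_isClosed_subset
      (isClosed_le hNcont continuous_const) ?_
    intro x hx
    rw [mem_closedBall_zero_iff]
    exact (hN1 x).trans hx
  have hKW : ∀ R, B / (1 - ρ) ≤ R → ∀ ℓ, ∀ x ∈ K R, W ℓ x ∈ K R := by
    intro R hR ℓ x hx
    rw [div_le_iff₀ (by linarith)] at hR
    change N (W ℓ x) ≤ R
    rw [hW]
    have h1 := hNadd (A x) (β ℓ)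
    have h2 := hNA x
    have h3 : N x ≤ R := hx
    nlinarith [hβB ℓ]
  choose φ hφm hφ0 hφi hφ using hpDini
  let S : ℝ → ℝ := fun t => min (1 - δ) (∑ ℓ, φ ℓ t)
  have hδ1 : δ ≤ 1 := by
    obtain ⟨ℓ⟩ := hL
    have h1 := hpsum 0
    have h2 := Finset.single_le_sum (f := fun ℓ => p ℓ 0) (fun ℓ _ => hp0 ℓ 0) (Finset.mem_univ ℓ)
    linarith [hplb ℓ 0]
  have hS0 : ∀ t, 0 ≤ t → 0 ≤ S t := fun t ht =>
    le_min (by linarith) (Finset.sum_nonneg fun ℓ _ => dini_nonneg (hφm ℓ) (hφ0 ℓ) ht)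
  have hS : ∀ x y t, 0 ≤ t → N (x - y) ≤ t → 1 - ∑ ℓ, min (p ℓ x) (p ℓ y) ≤ S t := by
    intro x y t ht hxy
    apply le_min
    · obtain ⟨ℓ⟩ := hL
      have h2 := Finset.single_le_sum (f := fun ℓ => min (p ℓ x) (p ℓ y))
        (fun ℓ _ => le_min (hp0 ℓ x) (hp0 ℓ y)) (Finset.mem_univ ℓ)
      have h3 : δ ≤ min (p ℓ x) (p ℓ y) := le_min (hplb _ _) (hplb _ _)
      linarith
    · rw [← hpsum x, ← Finset.sum_sub_distrib]
      apply Finset.sum_le_sum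
      intro ℓ _
      have h1 := (hφ ℓ x y).trans (hφm ℓ (Set.mem_Ici.2 dist_nonneg) (Set.mem_Ici.2 ht)
        ((dist_eq_norm x y).le.trans ((hN1 _).trans hxy)))
      refine le_trans ?_ h1
      rcases min_cases (p ℓ x) (p ℓ y) with ⟨h, _⟩ | ⟨h, _⟩ <;> rw [h]
      · simp
      · exact le_abs_self _
  have hsum : ∀ T, 0 ≤ T → Summable fun i : ℕ => S (ρ ^ i * T) := by
    intro T hT
    have h1 : Summable fun i : ℕ => ∑ ℓ, φ ℓ (ρ ^ i * T) :=
      summable_sum fun ℓ _ => dini_summable (hφm ℓ) (hφ0 ℓ) (hφi ℓ) hρ hρ1 T hT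
    exact Summable.of_nonneg_of_le (fun i => hS0 _ (by positivity)) (fun i => min_le_right _ _) h1
  have hd : ∀ ℓ x y, N (W ℓ x - W ℓ y) ≤ ρ * N (x - y) := by
    intro ℓ x y
    rw [hW, hW, add_sub_add_right_eq_sub, ← map_sub]
    exact hNA _
  have hosc : ∀ f : BoundedContinuousFunction E ℝ, ∀ R, B / (1 - ρ) ≤ R → 
      ∀ ε > 0, ∃ n0 : ℕ, ∀ n ≥ n0, ∀ x ∈ K R, ∀ y ∈ K R,
      |(trOp p W)^[n] f x - (trOp p W)^[n] f y| ≤ ε := by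
    intro f R hR
    have hR0 : 0 ≤ R := (div_nonneg hB0 (by linarith)).trans hR
    refine osc_tendsto hp0 hpsum (hKW R hR) (fun x y => N (x - y)) hρ hρ1 hd S hδ
      (fun t => min_le_left _ _) hS hS0 (T := R + R) (by positivity) (hsum _ (by positivity)) ?_
      (D0 := 2 * ‖f‖) ?_ ?_
    · intro x hx y hy
      have := hNadd x (-y)
      rw [hNneg, ← sub_eq_add_neg] at this
      have h1 : N x ≤ R := hx
      have h2 : N y ≤ R := hy
      linarith
    · intro x _ y _
      exact f.dist_le_two_norm x y
    · intro ε hε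
      have hu := (hKc R).uniformContinuousOn_of_continuous f.continuous.continuousOn
      rw [Metric.uniformContinuousOn_iff] at hu
      obtain ⟨η, hη, h⟩ := hu ε hε
      refine ⟨η / 2, by positivity, fun x hx y hy hxy => ?_⟩
      refine (h x hx y hy ?_).le
      rw [dist_eq_norm]
      have := (hN1 (x - y)).trans hxy
      linarith
  refine abstract_main hp0 hpsum hpc hWc ?_ (hKc (B / (1 - ρ))) (hKW _ le_rfl) (x0 := 0) ?_
  · intro f
    have h0K : ∀ R, B / (1 - ρ) ≤ R → (0 : E) ∈ K R := by
      intro R hR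
      change N 0 ≤ R
      rw [hN00]; exact (div_nonneg hB0 (by linarith)).trans hR
    obtain ⟨c, hc⟩ := trOp_cauchy hp0 hpsum (hKW _ le_rfl) (hosc f _ le_rfl) (h0K _ le_rfl)
    refine ⟨c, fun x => ?_⟩
    set R := max (B / (1 - ρ)) (N x)
    have hR : B / (1 - ρ) ≤ R := le_max_left _ _
    have hxK : x ∈ K R := le_max_right (B / (1 - ρ)) (N x)
    have hdiff : Tendsto (fun n => (trOp p W)^[n] f x - (trOp p W)^[n] f 0) atTop (𝓝 0) := by
      rw [Metric.tendsto_atTop]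
      intro ε hε
      obtain ⟨n0, hn0⟩ := hosc f R hR (ε / 2) (half_pos hε)
      refine ⟨n0, fun n hn => ?_⟩
      rw [Real.dist_eq, sub_zero]
      linarith [hn0 n hn x hxK 0 (h0K R hR)]
    simpa using hdiff.add hc
  · change N 0 ≤ _
    rw [hN00]; exact div_nonneg hB0 (by linarith)

/-- Proposition 1: two driver populations sharing one error signal, with two controllers.
The augmented matrix `𝒜` is block lower triangular with diagonal blocks the block diagonal
matrices of the Schur agent matrices `A₁ i`, `A₂ i` and the Schur controller matrices
`Ac₁, Ac₂`; the affine maps `W ℓ ξ = 𝒜 ξ + β ℓ` are chosen with Dini continuous probabilities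
bounded below by `δ > 0`.  Then the associated Markov kernel has a unique invariant Borel
probability measure, which is attractive. -/
theorem two_populations_two_controllers_unique_attractive_invariant_measure
    {N₁ N₂ : ℕ} {n₁ : Fin N₁ → ℕ} {n₂ : Fin N₂ → ℕ} {d₃ d₄ : ℕ}
    (A₁ : ∀ i : Fin N₁, Matrix (Fin (n₁ i)) (Fin (n₁ i)) ℝ)
    (A₂ : ∀ i : Fin N₂, Matrix (Fin (n₂ i)) (Fin (n₂ i)) ℝ)
    (Ac₁ : Matrix (Fin d₃) (Fin d₃) ℝ) (Ac₂ : Matrix (Fin d₄) (Fin d₄) ℝ)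
    (hA₁ : ∀ i, IsSchur (A₁ i)) (hA₂ : ∀ i, IsSchur (A₂ i))
    (hAc₁ : IsSchur Ac₁) (hAc₂ : IsSchur Ac₂)
    (𝒜 : Matrix (Idx4 N₁ N₂ n₁ n₂ d₃ d₄) (Idx4 N₁ N₂ n₁ n₂ d₃ d₄) ℝ)
    (hlower : ∀ i j, blk4 i < blk4 j → 𝒜 i j = 0)
    (hD₁ : ∀ a b, 𝒜 (Sum.inl a) (Sum.inl b) = Matrix.blockDiagonal' A₁ a b)
    (hD₂ : ∀ a b, 𝒜 (Sum.inr (Sum.inl a)) (Sum.inr (Sum.inl b)) = Matrix.blockDiagonal' A₂ a b)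
    (hD₃ : ∀ a b, 𝒜 (Sum.inr (Sum.inr (Sum.inl a))) (Sum.inr (Sum.inr (Sum.inl b))) = Ac₁ a b)
    (hD₄ : ∀ a b, 𝒜 (Sum.inr (Sum.inr (Sum.inr a))) (Sum.inr (Sum.inr (Sum.inr b))) = Ac₂ a b)
    {L : ℕ} (β : Fin L → EuclideanSpace ℝ (Idx4 N₁ N₂ n₁ n₂ d₃ d₄))
    (W : Fin L → EuclideanSpace ℝ (Idx4 N₁ N₂ n₁ n₂ d₃ d₄) →
      EuclideanSpace ℝ (Idx4 N₁ N₂ n₁ n₂ d₃ d₄))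
    (hW : ∀ ℓ ξ, W ℓ ξ = Matrix.toEuclideanLin 𝒜 ξ + β ℓ)
    (p : Fin L → EuclideanSpace ℝ (Idx4 N₁ N₂ n₁ n₂ d₃ d₄) → ℝ)
    (hp01 : ∀ ℓ x, p ℓ x ∈ Set.Icc (0 : ℝ) 1)
    (hpDini : ∀ ℓ, DiniContinuous (p ℓ))
    (hpsum : ∀ x, ∑ ℓ, p ℓ x = 1)
    (δ : ℝ) (hδ : 0 < δ) (hplb : ∀ ℓ x, δ ≤ p ℓ x) :
    ∃ μstar : Measure (EuclideanSpace ℝ (Idx4 N₁ N₂ n₁ n₂ d₃ d₄)),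
      (IsProbabilityMeasure μstar ∧ Invariant (IFSKernel p W) μstar) ∧
      (∀ μ : Measure (EuclideanSpace ℝ (Idx4 N₁ N₂ n₁ n₂ d₃ d₄)),
        IsProbabilityMeasure μ → Invariant (IFSKernel p W) μ → μ = μstar) ∧
      Attractive (IFSKernel p W) μstar := by
  have hS : IsSchur 𝒜 := schur4 A₁ A₂ Ac₁ Ac₂ hA₁ hA₂ hAc₁ hAc₂ 𝒜 hlower hD₁ hD₂ hD₃ hD₄
  obtain ⟨ρ, hρ, hρ1, C, hC⟩ := schur_pow hS
  exact affine_main (Matrix.toEuclideanLin 𝒜) hρ hρ1 hC β W hW p (fun ℓ x => (hp01 ℓ x).1) hpDini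
    hpsum δ hδ hplb
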